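/- arXiv:2012.11166 — 2 statements merged into one kernel-verified Lean document; each statement's English description precedes it below -/
import Mathlib

section
/- Assume q = 2, 1 ≤ s < d ≤ m, 1 ≤ r ≤ m−1, ms = d(m−r), let a = gcd(m,d) and assume a ≥ 2, and let U ⊆ F_{2^m} be an F_{2^a}-linear subspace of F_{2^a}-dimension d/a. Then at least a fraction 1/3 of the vectors of Ω lie outside bad(U); that is, 3·|Ω ∖ bad(U)| ≥ |Ω|. -/
open Finset

/-- `Ω`: the set of vectors in `E^k` whose entries are `F`-linearly independent. -/
def OmegaSet (F E : Type*) [Field F] [Field E] [Algebra F E] (k : ℕ) : Set (Fin k → E) :=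
  {x | LinearIndependent F x}

/-- `bad(U)`: the set of `x ∈ Ω` for which there is a not-all-zero tuple `u` with entries in `U`
such that `∑ⱼ uⱼ^{q^ℓ} xⱼ = 0` for all `1 ≤ ℓ ≤ s`. -/
def badSet (F : Type*) {E : Type*} [Field F] [Field E] [Algebra F E]
    (q s k : ℕ) (U : Set E) : Set (Fin k → E) :=
  {x | LinearIndependent F x ∧ ∃ u : Fin k → E, (∀ j, u j ∈ U) ∧ u ≠ 0 ∧
      ∀ ℓ : ℕ, 1 ≤ ℓ → ℓ ≤ s → ∑ j, u j ^ q ^ ℓ * x j = 0}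

section Moore

variable {F E : Type*} [Field F] [Fintype F] [Field E] [Algebra F E]

theorem frobeniusAlgHom_pow_apply (n : ℕ) (v : E) :
    (FiniteField.frobeniusAlgHom F E ^ n) v = v ^ Fintype.card F ^ n := by
  rw [AlgHom.coe_pow, FiniteField.coe_frobeniusAlgHom, pow_iterate]

theorem sum_smul_pow_card_pow {ι : Type*} [Fintype ι] (n : ℕ) (c : ι → F) (b : ι → E) :
    (∑ i, c i • b i) ^ Fintype.card F ^ n = ∑ i, c i • b i ^ Fintype.card F ^ n := by
  simp only [← frobeniusAlgHom_pow_apply, map_sum, map_smul]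

/-- A `q`-polynomial with terms of `q`-degrees `1, …, w` vanishing on a subspace of dimension at
least `w` is zero. -/
theorem eq_zero_of_sum_mul_pow_eq_zero [Finite E] {w : ℕ} (V : Submodule F E)
    (hV : w ≤ Module.finrank F V) (c : Fin w → E)
    (h : ∀ v ∈ V, ∑ l, c l * v ^ Fintype.card F ^ (l.1 + 1) = 0) : c = 0 := by
  classical
  have := Fintype.ofFinite E
  rcases w with - | w
  · exact Subsingleton.elim _ _
  have hq : 1 < Fintype.card F := Fintype.one_lt_card
  let P : Polynomial E :=
    ∑ l : Fin (w + 1), Polynomial.C (c l) * Polynomial.X ^ (Fintype.card F ^ l.1)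
  have hP : P = 0 := by
    refine Polynomial.eq_zero_of_natDegree_lt_card_of_eval_eq_zero P
      (f := fun v : V => (v : E) ^ Fintype.card F) ?_ ?_ ?_
    · exact (FiniteField.frobeniusAlgHom F E).toRingHom.injective.comp Subtype.val_injective
    · intro v
      rw [← h v v.2]
      simp only [P, Polynomial.eval_finsetSum, Polynomial.eval_mul, Polynomial.eval_C,
        Polynomial.eval_pow, Polynomial.eval_X, ← pow_mul, pow_succ']
    · rw [Module.card_eq_pow_finrank (K := F) (V := V)]
      refine lt_of_le_of_lt (Polynomial.natDegree_sum_le_of_forall_le (n := Fintype.card F ^ w)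
        _ _ fun l _ => ?_) (Nat.pow_lt_pow_right hq (by omega))
      exact (Polynomial.natDegree_C_mul_X_pow_le _ _).trans
        (Nat.pow_le_pow_right hq.le (by omega))
  funext l
  have h2 : P.coeff (Fintype.card F ^ l.1) = c l := by
    simp only [P, Polynomial.finsetSum_coeff, Polynomial.coeff_C_mul, Polynomial.coeff_X_pow]
    rw [Finset.sum_eq_single l]
    · simp
    · intro b _ hb
      rw [if_neg, mul_zero]
      intro h
      exact hb (Fin.ext (Nat.pow_right_injective hq h).symm)
    · simp
  rw [← h2, hP]
  simp

/-- If `∑ⱼ uⱼ^{q^ℓ} xⱼ = 0` for `1 ≤ ℓ ≤ s`, where `x` has `F`-linearly independent entries and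
`u ≠ 0`, then the entries of `u` span a space of dimension greater than `s`. -/
theorem lt_finrank_span_of_sum_pow_mul_eq_zero [Finite E] {s k : ℕ} {u x : Fin k → E}
    (hx : LinearIndependent F x) (hu : u ≠ 0)
    (h : ∀ l : ℕ, 1 ≤ l → l ≤ s → ∑ j, u j ^ Fintype.card F ^ l * x j = 0) :
    s < Module.finrank F (Submodule.span F (Set.range u)) := by
  classical
  by_contra! hw
  set V := Submodule.span F (Set.range u) with hVdef
  set w := Module.finrank F V with hwdef
  let b : Module.Basis (Fin w) F V := Module.finBasis F V
  let u' : Fin k → V := fun j => ⟨u j, Submodule.subset_span ⟨j, rfl⟩⟩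
  have hu' : ∀ j, u j = ∑ i, b.repr (u' j) i • (b i : E) := fun j => by
    have := congrArg V.subtype (b.sum_repr (u' j))
    rw [map_sum] at this
    exact this.symm
  let M : Matrix (Fin w) (Fin w) E :=
    Matrix.of fun l i => (b i : E) ^ Fintype.card F ^ (l.1 + 1)
  have hM : Function.Injective M.vecMul := by
    rw [← Matrix.coe_vecMulLinear, ← LinearMap.ker_eq_bot, LinearMap.ker_eq_bot']
    intro c hc
    refine eq_zero_of_sum_mul_pow_eq_zero V le_rfl c fun v hv => ?_
    have hv' : v = ∑ i, b.repr ⟨v, hv⟩ i • (b i : E) := by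
      have := congrArg V.subtype (b.sum_repr ⟨v, hv⟩)
      rw [map_sum] at this
      exact this.symm
    rw [hv']
    simp only [sum_smul_pow_card_pow, Finset.mul_sum, mul_smul_comm]
    rw [Finset.sum_comm]
    refine Finset.sum_eq_zero fun i _ => ?_
    rw [← Finset.smul_sum]
    have := congrFun hc i
    simp only [Matrix.coe_vecMulLinear, Matrix.vecMul, dotProduct, M, Matrix.of_apply,
      Pi.zero_apply] at this
    rw [this, smul_zero]
  rw [Matrix.vecMul_injective_iff_isUnit, ← Matrix.mulVec_injective_iff_isUnit] at hM
  let y : Fin w → E := fun i => ∑ j, b.repr (u' j) i • x j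
  have hy : y = 0 := by
    apply hM
    funext l
    rw [Matrix.mulVec_zero, Pi.zero_apply, ← h (l.1 + 1) (by omega) (by omega)]
    simp only [Matrix.mulVec, dotProduct, M, Matrix.of_apply, y, Finset.mul_sum]
    rw [Finset.sum_comm]
    refine Finset.sum_congr rfl fun j _ => ?_
    rw [hu' j, sum_smul_pow_card_pow, Finset.sum_mul]
    refine Finset.sum_congr rfl fun i _ => ?_
    rw [mul_smul_comm, smul_mul_assoc]
  apply hu
  funext j
  rw [hu' j]
  refine Finset.sum_eq_zero fun i _ => ?_
  rw [Fintype.linearIndependent_iff.1 hx (fun j => b.repr (u' j) i) (congrFun hy i) j, zero_smul]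

/-- If the entries of `u` span a space of dimension at least `s`, the solution space of
`∑ⱼ uⱼ^{q^ℓ} xⱼ = 0`, `1 ≤ ℓ ≤ s`, has codimension `s`. -/
theorem card_solutions_of_le_finrank_span [Finite E] {s k : ℕ} {u : Fin k → E}
    (hu : s ≤ Module.finrank F (Submodule.span F (Set.range u))) :
    {x : Fin k → E | ∀ l : ℕ, 1 ≤ l → l ≤ s →
      ∑ j, u j ^ Fintype.card F ^ l * x j = 0}.ncard = Nat.card E ^ (k - s) := by
  classical
  have := Fintype.ofFinite E
  let M : Matrix (Fin s) (Fin k) E :=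
    Matrix.of fun l j => u j ^ Fintype.card F ^ (l.1 + 1)
  have hM : LinearIndependent E M.row := by
    rw [← Matrix.vecMul_injective_iff, ← Matrix.coe_vecMulLinear, ← LinearMap.ker_eq_bot,
      LinearMap.ker_eq_bot']
    intro c hc
    refine eq_zero_of_sum_mul_pow_eq_zero _ hu c fun v hv => ?_
    obtain ⟨a, rfl⟩ := (Submodule.mem_span_range_iff_exists_fun F).1 hv
    simp only [sum_smul_pow_card_pow, Finset.mul_sum, mul_smul_comm]
    rw [Finset.sum_comm]
    refine Finset.sum_eq_zero fun i _ => ?_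
    rw [← Finset.smul_sum]
    have := congrFun hc i
    simp only [Matrix.coe_vecMulLinear, Matrix.vecMul, dotProduct, M, Matrix.of_apply,
      Pi.zero_apply] at this
    rw [this, smul_zero]
  have hrank := hM.rank_matrix
  rw [Fintype.card_fin, Matrix.rank] at hrank
  have hker := LinearMap.finrank_range_add_finrank_ker M.mulVecLin
  rw [hrank, Module.finrank_fin_fun] at hker
  have hset : {x : Fin k → E | ∀ l : ℕ, 1 ≤ l → l ≤ s →
      ∑ j, u j ^ Fintype.card F ^ l * x j = 0} = (LinearMap.ker M.mulVecLin : Set (Fin k → E)) := by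
    ext x
    simp only [Set.mem_ofPred_eq, SetLike.mem_coe, LinearMap.mem_ker, Matrix.mulVecLin_apply,
      funext_iff, Matrix.mulVec, dotProduct, M, Matrix.of_apply, Pi.zero_apply]
    constructor
    · intro h l
      exact h _ (by omega) (by omega)
    · intro h l hl hls
      have := h ⟨l - 1, by omega⟩
      simpa only [Nat.sub_add_cancel hl] using this
  rw [hset, ← Nat.card_coe_set_eq, Nat.card_eq_fintype_card, Nat.card_eq_fintype_card]
  have := Module.card_eq_pow_finrank (K := E) (V := LinearMap.ker M.mulVecLin)
  rw [show Module.finrank E (LinearMap.ker M.mulVecLin) = k - s by omega] at this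
  exact this

end Moore

theorem pow_mul_sub_le_mul_prod_pow_sub (m k : ℕ) (hk : k ≤ m) :
    (2 ^ m) ^ k * (2 ^ m - 2 ^ k) ≤ 2 ^ m * ∏ i : Fin k, (2 ^ m - 2 ^ i.1) := by
  induction k with
  | zero => simp
  | succ k ih =>
    have h := ih (by omega)
    rw [Fin.prod_univ_castSucc]
    simp only [Fin.val_castSucc, Fin.val_last]
    have h1 : 2 ^ (k + 1) ≤ 2 ^ m := Nat.pow_le_pow_right (by norm_num) hk
    obtain ⟨t, ht⟩ := Nat.exists_eq_add_of_le h1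
    generalize (∏ i : Fin k, (2 ^ m - 2 ^ i.1)) = P at *
    have e1 : 2 ^ m - 2 ^ (k + 1) = t := by omega
    have e2 : 2 ^ m - 2 ^ k = t + 2 ^ k := by rw [ht, pow_succ]; omega
    rw [e1]
    rw [e2] at h ⊢
    calc (2 ^ m) ^ (k + 1) * t = (2 ^ m) ^ k * (2 ^ m * t) := by ring
      _ ≤ (2 ^ m) ^ k * ((t + 2 ^ k) * (t + 2 ^ k)) := by
        refine Nat.mul_le_mul_left _ ?_
        rw [ht, pow_succ]
        nlinarith [Nat.zero_le (2 ^ k * 2 ^ k)]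
      _ = (2 ^ m) ^ k * (t + 2 ^ k) * (t + 2 ^ k) := by ring
      _ ≤ 2 ^ m * P * (t + 2 ^ k) := Nat.mul_le_mul_right _ h
      _ = _ := by ring

/-- Over a field with two elements, at least half of the `k`-tuples of vectors of an
`m`-dimensional space are linearly independent when `k < m`. -/
theorem card_pow_le_two_mul_ncard_omegaSet {F E : Type*} [Field F] [Fintype F] [Field E]
    [Finite E] [Algebra F E] (hF : Fintype.card F = 2) {k : ℕ} (hk : k < Module.finrank F E) :
    Nat.card E ^ k ≤ 2 * (OmegaSet F E k).ncard := by
  have := Fintype.ofFinite E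
  have hcard : Nat.card E = 2 ^ Module.finrank F E := by
    rw [Nat.card_eq_fintype_card, Module.card_eq_pow_finrank (K := F), hF]
  have h1 := card_linearIndependent (K := F) (V := E) hk.le
  have h2 : (OmegaSet F E k).ncard = _ := (Nat.card_coe_set_eq _).symm.trans h1
  rw [h2, hcard, hF]
  set m := Module.finrank F E
  have h3 := pow_mul_sub_le_mul_prod_pow_sub m k hk.le
  have h4 : 2 * 2 ^ k ≤ 2 ^ m := by
    rw [← pow_succ']; exact Nat.pow_le_pow_right (by norm_num) hk
  have h5 : (2 ^ m) ^ k * 2 ^ m ≤ (2 * ∏ i : Fin k, (2 ^ m - 2 ^ i.1)) * 2 ^ m := by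
    calc (2 ^ m) ^ k * 2 ^ m ≤ (2 ^ m) ^ k * (2 * (2 ^ m - 2 ^ k)) :=
          Nat.mul_le_mul_left _ (by omega)
      _ = 2 * ((2 ^ m) ^ k * (2 ^ m - 2 ^ k)) := by ring
      _ ≤ 2 * (2 ^ m * ∏ i : Fin k, (2 ^ m - 2 ^ i.1)) := Nat.mul_le_mul_left _ h3
      _ = _ := by ring
  exact Nat.le_of_mul_le_mul_right h5 (by positivity)

/-- Each bad vector has at least `|K| - 1` witnesses, since witnesses may be scaled by `K`, and
each nonzero tuple is a witness for at most `|E|^{k-s}` vectors of `Ω`. -/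
theorem ncard_badSet_mul_le {F K E : Type*} [Field F] [Fintype F] [Field K] [Fintype K]
    [Field E] [Finite E] [Algebra F E] [Algebra K E] (s k : ℕ) (U : Submodule K E) :
    (badSet F (Fintype.card F) s k (U : Set E)).ncard * (Fintype.card K - 1) ≤
      Nat.card U ^ k * Nat.card E ^ (k - s) := by
  classical
  have := Fintype.ofFinite E
  let R : (Fin k → E) → (Fin k → U) → Prop := fun x u =>
    LinearIndependent F x ∧
      ∀ l : ℕ, 1 ≤ l → l ≤ s → ∑ j, (u j : E) ^ Fintype.card F ^ l * x j = 0
  rw [Set.ncard_eq_toFinset_card']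
  refine (Finset.card_mul_le_card_mul R (t := Finset.univ.filter fun u : Fin k → U => u ≠ 0)
    (n := Nat.card E ^ (k - s)) ?_ ?_).trans
      (Nat.mul_le_mul_right _ ((Finset.card_le_univ _).trans ?_))
  · intro x hx
    rw [Set.mem_toFinset] at hx
    obtain ⟨hx, u, huU, hu, h⟩ := hx
    let u' : Fin k → U := fun j => ⟨u j, huU j⟩
    have hu' : u' ≠ 0 := fun h0 => hu (funext fun j => congrArg Subtype.val (congrFun h0 j))
    have hinj : Function.Injective fun c : K => c • u' := smul_left_injective K hu'
    have hc : Fintype.card K - 1 = (Finset.univ.erase (0 : K)).card := by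
      rw [Finset.card_erase_of_mem (Finset.mem_univ _), Finset.card_univ]
    rw [hc, ← Finset.card_image_of_injective _ hinj]
    refine Finset.card_le_card fun v hv => ?_
    obtain ⟨c, hc, rfl⟩ := Finset.mem_image.1 hv
    have hc0 : c ≠ 0 := (Finset.mem_erase.1 hc).1
    simp only [Finset.mem_bipartiteAbove, Finset.mem_filter, Finset.mem_univ, true_and]
    refine ⟨smul_ne_zero hc0 hu', hx, fun l hl hls => ?_⟩
    simp only [Pi.smul_apply, Submodule.coe_smul, smul_pow, smul_mul_assoc, u']
    rw [← Finset.smul_sum, h l hl hls, smul_zero]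
  · intro u hu
    have hu0 : (fun j => (u j : E)) ≠ 0 := fun h0 =>
      (Finset.mem_filter.1 hu).2 (funext fun j => Subtype.ext (congrFun h0 j))
    rcases Finset.eq_empty_or_nonempty (Finset.bipartiteBelow R
      (badSet F (Fintype.card F) s k (U : Set E)).toFinset u) with he | ⟨x, hx⟩
    · rw [he]; simp
    · have hR := ((Finset.mem_bipartiteBelow R).1 hx).2
      rw [← card_solutions_of_le_finrank_span
        (lt_finrank_span_of_sum_pow_mul_eq_zero hR.1 hu0 hR.2).le, ← Set.ncard_coe_finset]
      refine Set.ncard_le_ncard (fun y hy => ?_) (Set.toFinite _)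
      exact ((Finset.mem_bipartiteBelow R).1 hy).2.2
  · rw [Fintype.card_fun, Fintype.card_fin, Nat.card_eq_fintype_card]

/-- If `q = 2`, `1 ≤ s < d ≤ m`, `1 ≤ r ≤ m - 1`, `ms = d(m-r)`,
`a = gcd(m, d) ≥ 2` and `U ⊆ F_{2^m}` is an `F_{2^a}`-subspace of `F_{2^a}`-dimension `d/a`,
then at least a fraction `1/3` of the vectors of `Ω` lie outside `bad(U)`:
`3·|Ω \ bad(U)| ≥ |Ω|`. -/
theorem stmt_8 {F Fa E : Type*} [Field F] [Fintype F] [Field Fa] [Fintype Fa]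
    [Field E] [Fintype E] [Algebra F Fa] [Algebra Fa E] [Algebra F E] [IsScalarTower F Fa E]
    (q m s d r a : ℕ) (hq : Fintype.card F = q) (hq2 : q = 2) (hm : Module.finrank F E = m)
    (hs1 : 1 ≤ s) (hsd : s < d) (hdm : d ≤ m)
    (hr1 : 1 ≤ r) (hrm : r ≤ m - 1) (hms : m * s = d * (m - r))
    (ha : a = Nat.gcd m d) (ha2 : 2 ≤ a) (hqa : Fintype.card Fa = q ^ a)
    (U : Submodule Fa E) (hUa : Module.finrank Fa U = d / a) :
    (OmegaSet F E (m - r)).ncard ≤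
      3 * (OmegaSet F E (m - r) \ badSet F q s (m - r) (U : Set E)).ncard := by
  subst hq ha hm
  have hm : (Module.finrank F E) * s ≤ (Module.finrank F E) * (Module.finrank F E - r) := by
    rw [hms]; exact Nat.mul_le_mul_right _ hdm
  have hm0 : 0 < Module.finrank F E := by omega
  have hsk : s ≤ Module.finrank F E - r := Nat.le_of_mul_le_mul_left hm hm0
  have hΩ := card_pow_le_two_mul_ncard_omegaSet (F := F) (E := E) hq2
    (k := Module.finrank F E - r) (by omega)
  have hbad := ncard_badSet_mul_le (F := F) s (Module.finrank F E - r) U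
  have hsub : badSet F (Fintype.card F) s (Module.finrank F E - r) (U : Set E) ⊆
      OmegaSet F E (Module.finrank F E - r) := fun x hx => hx.1
  have hdiff := Set.ncard_sdiff_add_ncard_of_subset hsub (Set.toFinite _)
  have hE : Nat.card E = 2 ^ Module.finrank F E := by
    rw [Nat.card_eq_fintype_card, Module.card_eq_pow_finrank (K := F), hq2]
  have hU : Nat.card U = 2 ^ d := by
    rw [Module.natCard_eq_pow_finrank (K := Fa), Nat.card_eq_fintype_card, hqa, hq2, hUa, ← pow_mul,
      Nat.mul_div_cancel' (Nat.gcd_dvd_right _ _)]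
  have hU' : Nat.card U ^ (Module.finrank F E - r) * Nat.card E ^ (Module.finrank F E - r - s) =
      Nat.card E ^ (Module.finrank F E - r) := by
    rw [hU, ← pow_mul, ← hms, pow_mul, ← hE, ← pow_add, Nat.add_sub_cancel' hsk]
  rw [hU'] at hbad
  have hK : 2 ^ 2 ≤ Fintype.card Fa := by
    rw [hqa, hq2]; exact Nat.pow_le_pow_right (by norm_num) ha2
  have h3 := (Nat.mul_le_mul_left
    (badSet F (Fintype.card F) s (Module.finrank F E - r) (U : Set E)).ncard
    (show 3 ≤ Fintype.card Fa - 1 by omega)).trans hbad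
  omega
end

section
/- Let s ≥ 1 and let U, V be F_q-linear subspaces of F_{q^m} of dimensions d and r respectively, with ms ≥ d(m−r). Let U^{∧q^{s+1}} = { u^{q^{s+1}} : u ∈ U } (an F_q-subspace of dimension d). Then the pair (U, V) is good if and only if the pair (V^⊥, (U^{∧q^{s+1}})^⊥) is good (with the same parameter s, the first subspace having dimension m−r and the second dimension m−d). -/
open Finset

/-- The trace-dual of an `F`-subspace `V` of `E`, where `Tr(x) = ∑_{i<m} x^{q^i}`:
`V^⊥ = {x : ∀ v ∈ V, Tr(v*x) = 0}`. -/
def traceDual {F E : Type*} [Field F] [Fintype F] [Field E] [Fintype E] [Algebra F E]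
    (q m : ℕ) (hq : Fintype.card F = q) (V : Submodule F E) : Submodule F E where
  carrier := {x : E | ∀ v ∈ V, ∑ i ∈ Finset.range m, (v * x) ^ q ^ i = 0}
  zero_mem' := by
    intro v hv
    have hq0 : q ≠ 0 := by
      have h1 : 0 < Fintype.card F := Fintype.card_pos
      omega
    refine Finset.sum_eq_zero fun i _ => ?_
    rw [mul_zero, zero_pow (pow_ne_zero i hq0)]
  add_mem' := by
    intro x y hx hy v hv
    obtain ⟨n, hp, hcard⟩ := FiniteField.card F (ringChar F)
    haveI : Fact (Nat.Prime (ringChar F)) := ⟨hp⟩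
    haveI : CharP E (ringChar F) :=
      charP_of_injective_algebraMap (algebraMap F E).injective (ringChar F)
    have hq' : q = ringChar F ^ (n : ℕ) := by rw [← hq, hcard]
    have key : ∀ a b : E, ∀ i : ℕ, (a + b) ^ q ^ i = a ^ q ^ i + b ^ q ^ i := by
      intro a b i
      rw [hq', ← pow_mul]
      exact add_pow_char_pow a b (ringChar F) ((n : ℕ) * i)
    calc ∑ i ∈ Finset.range m, (v * (x + y)) ^ q ^ i
        = ∑ i ∈ Finset.range m, ((v * x) ^ q ^ i + (v * y) ^ q ^ i) := by
          refine Finset.sum_congr rfl fun i _ => ?_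
          rw [mul_add, key]
      _ = 0 := by rw [Finset.sum_add_distrib, hx v hv, hy v hv, add_zero]
  smul_mem' := by
    intro c x hx v hv
    have hc : ∀ i : ℕ, (algebraMap F E c) ^ q ^ i = algebraMap F E c := by
      intro i
      rw [← map_pow]
      congr 1
      calc c ^ q ^ i = c ^ Fintype.card F ^ i := by rw [hq]
        _ = c := FiniteField.pow_card_pow i c
    calc ∑ i ∈ Finset.range m, (v * (c • x)) ^ q ^ i
        = ∑ i ∈ Finset.range m, algebraMap F E c * (v * x) ^ q ^ i := by
          refine Finset.sum_congr rfl fun i _ => ?_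
          rw [Algebra.smul_def, mul_left_comm, mul_pow, hc]
      _ = algebraMap F E c * ∑ i ∈ Finset.range m, (v * x) ^ q ^ i := (Finset.mul_sum _ _ _).symm
      _ = 0 := by rw [hx v hv, mul_zero]

/-- A pair `(U, V)` of `F`-subspaces of `E` is *good* (for the parameter `s`) if
`m·s ≥ dim U · (m - dim V)` and for every `F`-basis `u₁, …, u_{dim U}` of `U` and all
`v'ᵢ ∈ V^⊥`: if `∑ᵢ v'ᵢ · uᵢ^{q^ℓ} = 0` for every `1 ≤ ℓ ≤ s`, then all `v'ᵢ = 0`. -/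
def IsGoodPair {F E : Type*} [Field F] [Fintype F] [Field E] [Fintype E] [Algebra F E]
    (q m s : ℕ) (hq : Fintype.card F = q) (U V : Submodule F E) : Prop :=
  m * s ≥ Module.finrank F U * (m - Module.finrank F V) ∧
  ∀ u : Fin (Module.finrank F U) → E,
    (∀ i, u i ∈ U) → LinearIndependent F u → Submodule.span F (Set.range u) = U →
  ∀ v' : Fin (Module.finrank F U) → E,
    (∀ i, v' i ∈ traceDual q m hq V) →
    (∀ ℓ : ℕ, 1 ≤ ℓ → ℓ ≤ s → ∑ i, v' i * u i ^ q ^ ℓ = 0) →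
    ∀ i, v' i = 0

/-- The `F`-linear map `x ↦ x^{q^t}` on `E` (an iterate of the Frobenius). -/
def frobPow {F E : Type*} [Field F] [Fintype F] [Field E] [Fintype E] [Algebra F E]
    (q t : ℕ) (hq : Fintype.card F = q) : E →ₗ[F] E where
  toFun x := x ^ q ^ t
  map_add' := by
    intro x y
    obtain ⟨n, hp, hcard⟩ := FiniteField.card F (ringChar F)
    haveI : Fact (Nat.Prime (ringChar F)) := ⟨hp⟩
    haveI : CharP E (ringChar F) :=
      charP_of_injective_algebraMap (algebraMap F E).injective (ringChar F)
    have hq' : q = ringChar F ^ (n : ℕ) := by rw [← hq, hcard]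
    simp only [hq', ← pow_mul]
    exact add_pow_char_pow x y (ringChar F) ((n : ℕ) * t)
  map_smul' := by
    intro c x
    simp only [RingHom.id_apply]
    have hc : c ^ q ^ t = c := by
      rw [← hq]; exact FiniteField.pow_card_pow t c
    rw [Algebra.smul_def, Algebra.smul_def, mul_pow, ← map_pow, hc]

/-- A family of bilinear maps `B i` is jointly nondegenerate on the tensors `∑ u_j ⊗ w_j` with
`u` a basis of `U` and `w_j ∈ W`. -/
def JointlyInjective {F E ι : Type*} [Field F] [AddCommGroup E] [Module F E]
    (B : ι → E →ₗ[F] E →ₗ[F] E) (U W : Submodule F E) : Prop :=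
  ∀ u : Fin (Module.finrank F U) → E,
    (∀ i, u i ∈ U) → LinearIndependent F u → Submodule.span F (Set.range u) = U →
  ∀ w : Fin (Module.finrank F U) → E, (∀ i, w i ∈ W) →
    (∀ k, ∑ i, B k (u i) (w i) = 0) → ∀ i, w i = 0

theorem JointlyInjective.flip {F E ι : Type*} [Field F] [AddCommGroup E] [Module F E]
    [FiniteDimensional F E] {B : ι → E →ₗ[F] E →ₗ[F] E} {U W : Submodule F E}
    (h : JointlyInjective B U W) : JointlyInjective (fun k => (B k).flip) W U := by
  intro w hwW hw _ x hx h0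
  let b := Module.finBasis F U
  have hb : LinearIndependent F (fun i => (b i : E)) :=
    b.linearIndependent.map' U.subtype U.ker_subtype
  have hspan : Submodule.span F (Set.range fun i => (b i : E)) = U := by
    have h1 : (Set.range fun i => (b i : E)) = U.subtype '' Set.range b := by
      rw [← Set.range_comp]; rfl
    rw [h1, Submodule.span_image, b.span_eq, Submodule.map_top, U.range_subtype]
  let c := fun j i => b.repr ⟨x j, hx j⟩ i
  have hxc : ∀ j, x j = ∑ i, c j i • (b i : E) := fun j => by
    have h1 := congrArg U.subtype (b.sum_repr ⟨x j, hx j⟩)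
    rw [map_sum] at h1
    exact h1.symm
  have hc := h (fun i => b i) (fun i => (b i).2) hb hspan (fun i => ∑ j, c j i • w j)
    (fun i => W.sum_mem fun j _ => W.smul_mem _ (hwW j)) fun k => by
      rw [← h0 k]
      simp only [LinearMap.flip_apply, map_sum, map_smul]
      rw [Finset.sum_comm]
      refine Finset.sum_congr rfl fun j _ => ?_
      conv_rhs => rw [hxc j]
      simp [map_sum, LinearMap.sum_apply]
  intro j
  rw [hxc j]
  refine Finset.sum_eq_zero fun i _ => ?_
  rw [Fintype.linearIndependent_iff.1 hw (fun j => c j i) (hc i) j, zero_smul]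

theorem jointlyInjective_flip_iff {F E ι : Type*} [Field F] [AddCommGroup E] [Module F E]
    [FiniteDimensional F E] {B : ι → E →ₗ[F] E →ₗ[F] E} {U W : Submodule F E} :
    JointlyInjective (fun k => (B k).flip) W U ↔ JointlyInjective B U W :=
  ⟨fun h => h.flip, fun h => h.flip⟩

section FiniteField

variable {F E : Type*} [Field F] [Fintype F] [Field E] [Fintype E] [Algebra F E]

theorem traceDual_eq_orthogonal (q m : ℕ) (hq : Fintype.card F = q)
    (hm : Module.finrank F E = m) (V : Submodule F E) :
    traceDual q m hq V = (Algebra.traceForm F E).orthogonal V := by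
  ext x
  have key : ∀ v : E, ∑ i ∈ Finset.range m, (v * x) ^ q ^ i
      = algebraMap F E (Algebra.trace F E (v * x)) := fun v => by
    rw [FiniteField.algebraMap_trace_eq_sum_pow, hm, Nat.card_eq_fintype_card, hq]
  change (∀ v ∈ V, ∑ i ∈ Finset.range m, (v * x) ^ q ^ i = 0) ↔ _
  simp only [key, map_eq_zero, LinearMap.BilinForm.mem_orthogonal_iff, Algebra.traceForm_apply]

theorem finrank_traceDual (q m : ℕ) (hq : Fintype.card F = q)
    (hm : Module.finrank F E = m) (V : Submodule F E) :
    Module.finrank F (traceDual q m hq V) = m - Module.finrank F V := by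
  rw [traceDual_eq_orthogonal q m hq hm, ← hm]
  exact LinearMap.BilinForm.finrank_orthogonal (traceForm_nondegenerate F E) V

theorem traceDual_traceDual (q m : ℕ) (hq : Fintype.card F = q)
    (hm : Module.finrank F E = m) (V : Submodule F E) :
    traceDual q m hq (traceDual q m hq V) = V := by
  rw [traceDual_eq_orthogonal q m hq hm, traceDual_eq_orthogonal q m hq hm]
  exact LinearMap.BilinForm.orthogonal_orthogonal (traceForm_nondegenerate F E)
    (Algebra.traceForm_isSymm F (S := E)).isRefl V

theorem frobPow_apply (q t : ℕ) (hq : Fintype.card F = q) (x : E) :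
    frobPow q t hq x = x ^ q ^ t := rfl

theorem frobPow_injective (q t : ℕ) (hq : Fintype.card F = q) :
    Function.Injective (frobPow q t hq : E →ₗ[F] E) := by
  rw [injective_iff_map_eq_zero]
  intro x hx
  exact eq_zero_of_pow_eq_zero hx

theorem frobPow_mul_frobPow (q : ℕ) (hq : Fintype.card F = q) {l t : ℕ} (hlt : l ≤ t) (x w : E) :
    frobPow q t hq x * frobPow q l hq w
      = frobPow q l hq (w * frobPow q (t - l) hq x) := by
  simp only [frobPow_apply, mul_pow]
  rw [← pow_mul, ← pow_add, Nat.sub_add_cancel hlt, mul_comm]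

/-- The bilinear maps `(u, w) ↦ w * u ^ q ^ l` for `1 ≤ l ≤ s`. -/
def frobBilin (q s : ℕ) (hq : Fintype.card F = q) (l : Set.Icc 1 s) : E →ₗ[F] E →ₗ[F] E :=
  (LinearMap.mul F E).comp (frobPow q l hq)

theorem frobBilin_apply (q s : ℕ) (hq : Fintype.card F = q) (l : Set.Icc 1 s) (u w : E) :
    frobBilin q s hq l u w = w * u ^ q ^ (l : ℕ) := mul_comm _ _

theorem isGoodPair_iff (q m s : ℕ) (hq : Fintype.card F = q) (U V : Submodule F E) :
    IsGoodPair q m s hq U V ↔ Module.finrank F U * (m - Module.finrank F V) ≤ m * s ∧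
      JointlyInjective (frobBilin q s hq) U (traceDual q m hq V) := by
  simp only [IsGoodPair, JointlyInjective, frobBilin_apply, Subtype.forall, Set.mem_Icc, and_imp,
    ge_iff_le]

theorem jointlyInjective_map_frobPow_iff (q s : ℕ) (hq : Fintype.card F = q)
    (U W : Submodule F E) :
    JointlyInjective (frobBilin q s hq) W (U.map (frobPow q (s + 1) hq)) ↔
      JointlyInjective (fun l => (frobBilin q s hq l).flip) W U := by
  have key : ∀ l : ℕ, l ≤ s → ∀ n (w x : Fin n → E),
      ∑ j, frobPow q (s + 1) hq (x j) * w j ^ q ^ l = 0 ↔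
        ∑ j, w j * x j ^ q ^ (s + 1 - l) = 0 := fun l hl n w x => by
    rw [← map_eq_zero_iff (frobPow q l hq) (frobPow_injective q l hq)
      (x := ∑ j, w j * x j ^ q ^ (s + 1 - l)), map_sum]
    refine Eq.congr_left (Finset.sum_congr rfl fun j _ => ?_)
    exact frobPow_mul_frobPow q hq (by omega) (x j) (w j)
  simp only [JointlyInjective, frobBilin_apply, LinearMap.flip_apply, Subtype.forall, Set.mem_Icc]
  refine forall_congr' fun w => imp_congr_right fun _ => imp_congr_right fun _ =>
    imp_congr_right fun _ => ⟨fun h x hx h0 j => ?_, fun h y hy h0 j => ?_⟩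
  · refine frobPow_injective q (s + 1) hq ?_
    rw [map_zero]
    refine h (fun j => frobPow q (s + 1) hq (x j))
      (fun j => Submodule.mem_map_of_mem (hx j)) (fun l hl => ?_) j
    exact (key l hl.2 _ w x).2 (h0 (s + 1 - l) (by omega))
  · choose x hxU hxy using hy
    obtain rfl : (fun j => frobPow q (s + 1) hq (x j)) = y := funext hxy
    have hx := h x hxU (fun l hl => by
      have := (key (s + 1 - l) (by omega) _ w x).1 (h0 (s + 1 - l) (by omega))
      rwa [Nat.sub_sub_self (by omega)] at this) j
    change frobPow q (s + 1) hq (x j) = 0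
    rw [hx, map_zero]

end FiniteField

/-- For `F_q`-subspaces `U, V ⊆ F_{q^m}` of dimensions `d` and `r` with
`ms ≥ d(m-r)`, and `U^{∧q^{s+1}} = {u^{q^{s+1}} : u ∈ U}`, the pair `(U, V)` is good if and
only if the pair `(V^⊥, (U^{∧q^{s+1}})^⊥)` is good (with the same parameter `s`). -/
theorem stmt_14 {F E : Type*} [Field F] [Fintype F] [Field E] [Fintype E] [Algebra F E]
    (q m s d r : ℕ) (hq : Fintype.card F = q) (hm : Module.finrank F E = m) (hs1 : 1 ≤ s)
    (U V : Submodule F E) (hU : Module.finrank F U = d) (hV : Module.finrank F V = r)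
    (hms : d * (m - r) ≤ m * s) :
    IsGoodPair q m s hq U V ↔
      IsGoodPair q m s hq (traceDual q m hq V)
        (traceDual q m hq (U.map (frobPow q (s + 1) hq))) := by
  have hUm : Module.finrank F U ≤ m := hm ▸ Submodule.finrank_le U
  have hmap : Module.finrank F (U.map (frobPow q (s + 1) hq)) = Module.finrank F U :=
    (Submodule.equivMapOfInjective _ (frobPow_injective q (s + 1) hq) U).finrank_eq.symm
  rw [isGoodPair_iff, isGoodPair_iff, traceDual_traceDual q m hq hm,
    jointlyInjective_map_frobPow_iff, jointlyInjective_flip_iff,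
    finrank_traceDual q m hq hm, finrank_traceDual q m hq hm, hmap, Nat.sub_sub_self hUm,
    mul_comm (Module.finrank F U)]
end
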